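/- Assume 2σ₁² ≤ r < σ₂². Let A = (λ₁ + 2)/(2λ₁), B = (λ₁ − 2)/(2λ₁) and let F be defined by F(x) = A·exp(λ₁ x) + B·exp(−λ₁ x) for x ≤ 0 and F(x) = (1+x)² for x ≥ 0 (so F is continuously differentiable at 0). Define R : ℝ → ℝ by R(x) = ψ′(x)·F(x) − ψ(x)·F′(x). Then R is constant on (−∞, 0) and R is strictly decreasing on the interval (0, σ₂/√r − 1); in particular R is not non-decreasing on ℝ. -/

import Mathlib

open Real Filter Set

/-- The increasing fundamental solution ψ for the oscillating Brownian motion with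
volatility `σ₁` on `(-∞,0)` and `σ₂` on `(0,∞)`, discount parameter `r`. -/
noncomputable def psi (σ₁ σ₂ r x : ℝ) : ℝ :=
  if x < 0 then Real.exp (Real.sqrt (2*r)/σ₁ * x)
  else (1 + σ₂/σ₁)/2 * Real.exp (Real.sqrt (2*r)/σ₂ * x)
     + (1 - σ₂/σ₁)/2 * Real.exp (-(Real.sqrt (2*r)/σ₂) * x)

/-- Candidate value function: r-harmonic on (−∞,0) glued to the quadratic
reward (1+x)² at 0. -/
noncomputable def Ffun (σ₁ r A B x : ℝ) : ℝ :=
  if x < 0 then A * Real.exp (Real.sqrt (2*r)/σ₁ * x)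
              + B * Real.exp (-(Real.sqrt (2*r)/σ₁) * x)
  else (1 + x)^2

theorem hasDerivAt_exp_const_mul (c x : ℝ) :
    HasDerivAt (fun y => Real.exp (c * y)) (c * Real.exp (c * x)) x := by
  simpa [mul_comm] using ((hasDerivAt_id x).const_mul c).exp

theorem hasDerivAt_exp_combination (c A B x : ℝ) :
    HasDerivAt (fun y => A * Real.exp (c * y) + B * Real.exp (-c * y))
      (c * A * Real.exp (c * x) - c * B * Real.exp (-c * x)) x := by
  refine (((hasDerivAt_exp_const_mul c x).const_mul A).add
    ((hasDerivAt_exp_const_mul (-c) x).const_mul B)).congr_deriv ?_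
  ring

theorem hasDerivAt_psi_of_neg (σ₁ σ₂ r : ℝ) {x : ℝ} (hx : x < 0) :
    HasDerivAt (psi σ₁ σ₂ r)
      (Real.sqrt (2*r)/σ₁ * Real.exp (Real.sqrt (2*r)/σ₁ * x)) x := by
  refine (hasDerivAt_exp_const_mul _ x).congr_of_eventuallyEq ?_
  filter_upwards [Iio_mem_nhds hx] with y hy
  exact if_pos hy

theorem hasDerivAt_psi_of_pos (σ₁ σ₂ r : ℝ) {x : ℝ} (hx : 0 < x) :
    HasDerivAt (psi σ₁ σ₂ r)
      (Real.sqrt (2*r)/σ₂ * ((1 + σ₂/σ₁)/2) * Real.exp (Real.sqrt (2*r)/σ₂ * x)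
        - Real.sqrt (2*r)/σ₂ * ((1 - σ₂/σ₁)/2) * Real.exp (-(Real.sqrt (2*r)/σ₂) * x)) x := by
  refine (hasDerivAt_exp_combination _ _ _ x).congr_of_eventuallyEq ?_
  filter_upwards [Ioi_mem_nhds hx] with y hy
  exact if_neg (not_lt.2 (le_of_lt hy))

theorem hasDerivAt_Ffun_of_neg (σ₁ r A B : ℝ) {x : ℝ} (hx : x < 0) :
    HasDerivAt (Ffun σ₁ r A B)
      (Real.sqrt (2*r)/σ₁ * A * Real.exp (Real.sqrt (2*r)/σ₁ * x)
        - Real.sqrt (2*r)/σ₁ * B * Real.exp (-(Real.sqrt (2*r)/σ₁) * x)) x := by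
  refine (hasDerivAt_exp_combination _ _ _ x).congr_of_eventuallyEq ?_
  filter_upwards [Iio_mem_nhds hx] with y hy
  exact if_pos hy

theorem hasDerivAt_one_add_sq (x : ℝ) :
    HasDerivAt (fun y : ℝ => (1 + y)^2) (2 * (1 + x)) x := by
  simpa using ((hasDerivAt_id x).const_add 1).fun_pow 2

theorem hasDerivAt_Ffun_of_pos (σ₁ r A B : ℝ) {x : ℝ} (hx : 0 < x) :
    HasDerivAt (Ffun σ₁ r A B) (2 * (1 + x)) x := by
  refine (hasDerivAt_one_add_sq x).congr_of_eventuallyEq ?_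
  filter_upwards [Ioi_mem_nhds hx] with y hy
  exact if_neg (not_lt.2 (le_of_lt hy))

/-- The Wronskian of `psi` and `Ffun` on the negative half-line. -/
theorem wronskian_of_neg (σ₁ σ₂ r A B : ℝ) {x : ℝ} (hx : x < 0) :
    deriv (psi σ₁ σ₂ r) x * Ffun σ₁ r A B x - psi σ₁ σ₂ r x * deriv (Ffun σ₁ r A B) x
      = 2 * (Real.sqrt (2*r)/σ₁) * B := by
  rw [(hasDerivAt_psi_of_neg σ₁ σ₂ r hx).deriv, (hasDerivAt_Ffun_of_neg σ₁ r A B hx).deriv]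
  simp only [psi, Ffun, if_pos hx]
  have h : Real.exp (Real.sqrt (2*r)/σ₁ * x) * Real.exp (-(Real.sqrt (2*r)/σ₁) * x) = 1 := by
    rw [← Real.exp_add, neg_mul, add_neg_cancel, Real.exp_zero]
  linear_combination 2 * (Real.sqrt (2*r)/σ₁) * B * h

/-- The Wronskian of `psi` and `Ffun` on the positive half-line has derivative
`ψ'' F - ψ F'' = ψ (λ₂² (1 + x)² - 2)`. -/
theorem hasDerivAt_wronskian_of_pos (σ₁ σ₂ r A B : ℝ) {x : ℝ} (hx : 0 < x) :
    HasDerivAt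
      (fun y => deriv (psi σ₁ σ₂ r) y * Ffun σ₁ r A B y
        - psi σ₁ σ₂ r y * deriv (Ffun σ₁ r A B) y)
      (psi σ₁ σ₂ r x * ((Real.sqrt (2*r)/σ₂)^2 * (1 + x)^2 - 2)) x := by
  have hψ' : HasDerivAt (deriv (psi σ₁ σ₂ r))
      ((Real.sqrt (2*r)/σ₂)^2 * psi σ₁ σ₂ r x) x := by
    have h := hasDerivAt_exp_combination (Real.sqrt (2*r)/σ₂)
      (Real.sqrt (2*r)/σ₂ * ((1 + σ₂/σ₁)/2)) (-(Real.sqrt (2*r)/σ₂ * ((1 - σ₂/σ₁)/2))) x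
    refine (h.congr_of_eventuallyEq ?_).congr_deriv ?_
    · filter_upwards [Ioi_mem_nhds hx] with y hy
      rw [(hasDerivAt_psi_of_pos σ₁ σ₂ r hy).deriv]
      ring
    · simp only [psi, if_neg hx.not_gt]
      ring
  have hF' : HasDerivAt (deriv (Ffun σ₁ r A B)) 2 x := by
    have h : HasDerivAt (fun y : ℝ => 2 * (1 + y)) 2 x := by
      simpa using ((hasDerivAt_id x).const_add 1).const_mul 2
    refine h.congr_of_eventuallyEq ?_
    filter_upwards [Ioi_mem_nhds hx] with y hy
    exact (hasDerivAt_Ffun_of_pos σ₁ r A B hy).deriv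
  have hψ := (hasDerivAt_psi_of_pos σ₁ σ₂ r hx).differentiableAt.hasDerivAt
  have hF := (hasDerivAt_Ffun_of_pos σ₁ r A B hx).differentiableAt.hasDerivAt
  refine ((hψ'.mul hF).sub (hψ.mul hF')).congr_deriv ?_
  have hFx : Ffun σ₁ r A B x = (1 + x)^2 := if_neg hx.not_gt
  rw [hFx]
  ring

theorem psi_pos_of_pos {σ₁ σ₂ : ℝ} (hσ₁ : 0 < σ₁) (hσ₂ : 0 < σ₂) (r : ℝ) {x : ℝ}
    (hx : 0 < x) : 0 < psi σ₁ σ₂ r x := by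
  simp only [psi, if_neg hx.not_gt]
  have hs : 0 < σ₂/σ₁ := div_pos hσ₂ hσ₁
  have hle : Real.exp (-(Real.sqrt (2*r)/σ₂) * x) ≤ Real.exp (Real.sqrt (2*r)/σ₂ * x) := by
    have : 0 ≤ Real.sqrt (2*r)/σ₂ * x := by positivity
    exact Real.exp_le_exp.2 (by linarith)
  have h₁ := Real.exp_pos (Real.sqrt (2*r)/σ₂ * x)
  have h₂ := Real.exp_pos (-(Real.sqrt (2*r)/σ₂) * x)
  nlinarith [mul_nonneg hs.le (sub_nonneg.2 hle)]

/-- Assume 2σ₁² ≤ r < σ₂². With A = (λ₁+2)/(2λ₁), B = (λ₁−2)/(2λ₁) and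
R(x) = ψ′(x)·F(x) − ψ(x)·F′(x), the function R is constant on (−∞,0) and strictly
decreasing on (0, σ₂/√r − 1); in particular R is not non-decreasing on ℝ. -/
theorem stmt_15 (σ₁ σ₂ r : ℝ) (hσ₁ : 0 < σ₁) (hσ₂ : 0 < σ₂)
    (hr1 : 2*σ₁^2 ≤ r) (hr2 : r < σ₂^2) :
    ∀ F R : ℝ → ℝ,
      F = Ffun σ₁ r ((Real.sqrt (2*r)/σ₁ + 2)/(2*(Real.sqrt (2*r)/σ₁)))
                    ((Real.sqrt (2*r)/σ₁ - 2)/(2*(Real.sqrt (2*r)/σ₁))) →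
      R = (fun x => deriv (psi σ₁ σ₂ r) x * F x - psi σ₁ σ₂ r x * deriv F x) →
      (∀ x ∈ Set.Iio (0:ℝ), ∀ y ∈ Set.Iio (0:ℝ), R x = R y) ∧
      StrictAntiOn R (Set.Ioo 0 (σ₂/Real.sqrt r - 1)) ∧
      ¬ Monotone R := by
  rintro F R rfl rfl
  have hr : 0 < r := lt_of_lt_of_le (by positivity) hr1
  have hsr : 0 < Real.sqrt r := Real.sqrt_pos.2 hr
  have hanti : StrictAntiOn
      (fun x => deriv (psi σ₁ σ₂ r) x
          * Ffun σ₁ r ((Real.sqrt (2*r)/σ₁ + 2)/(2*(Real.sqrt (2*r)/σ₁)))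
              ((Real.sqrt (2*r)/σ₁ - 2)/(2*(Real.sqrt (2*r)/σ₁))) x
        - psi σ₁ σ₂ r x
          * deriv (Ffun σ₁ r ((Real.sqrt (2*r)/σ₁ + 2)/(2*(Real.sqrt (2*r)/σ₁)))
              ((Real.sqrt (2*r)/σ₁ - 2)/(2*(Real.sqrt (2*r)/σ₁)))) x)
      (Set.Ioo 0 (σ₂/Real.sqrt r - 1)) := by
    refine strictAntiOn_of_deriv_neg (convex_Ioo _ _) (fun x hx =>
      (hasDerivAt_wronskian_of_pos σ₁ σ₂ r _ _ hx.1).continuousAt.continuousWithinAt) ?_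
    intro x hx
    rw [interior_Ioo] at hx
    rw [(hasDerivAt_wronskian_of_pos σ₁ σ₂ r _ _ hx.1).deriv]
    refine mul_neg_of_pos_of_neg (psi_pos_of_pos hσ₁ hσ₂ r hx.1) ?_
    have hlt : (1 + x) * Real.sqrt r < σ₂ := (lt_div_iff₀ hsr).1 (by linarith [hx.2])
    have hsq : ((1 + x) * Real.sqrt r)^2 < σ₂^2 :=
      pow_lt_pow_left₀ hlt (mul_nonneg (by linarith [hx.1]) hsr.le) two_ne_zero
    rw [mul_pow, Real.sq_sqrt hr.le] at hsq
    rw [div_pow, Real.sq_sqrt (by positivity), sub_neg, div_mul_eq_mul_div,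
      div_lt_iff₀ (by positivity)]
    linarith
  refine ⟨fun x hx y hy => ?_, hanti, fun hmono => ?_⟩
  · exact (wronskian_of_neg σ₁ σ₂ r _ _ hx).trans (wronskian_of_neg σ₁ σ₂ r _ _ hy).symm
  · have hb : 0 < σ₂/Real.sqrt r - 1 := by
      rw [sub_pos, one_lt_div hsr]
      exact (Real.sqrt_lt' hσ₂).2 hr2
    obtain ⟨y, hy₀, hy⟩ := exists_between hb
    obtain ⟨x, hx₀, hxy⟩ := exists_between hy₀
    exact absurd (hmono hxy.le) (not_le.2 (hanti ⟨hx₀, hxy.trans hy⟩ ⟨hy₀, hy⟩ hxy))
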